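/- arXiv:2602.00966 — 3 statements merged into one kernel-verified Lean document; each statement's English description precedes it below -/
import Mathlib

section
/- One-step regret bound for LinUCB (Lemma 2). Fix a round t. Let A be a positive definite d×d real matrix, θ̂, θ* ∈ ℝ^d with ‖θ̂ − θ*‖_A ≤ β for some β ≥ 0, where ‖v‖_M = √(vᵀ M v). Let C be a finite nonempty set of arms, each arm j having a context x_j ∈ ℝ^d and expected reward μ_j = x_jᵀθ*. Define UCB_j = x_jᵀθ̂ + β·√(x_jᵀ A⁻¹ x_j), and let a ∈ C maximize UCB_j over j ∈ C. Let j* ∈ C be an arm maximizing μ_j over j ∈ C. Then μ_{j*} − μ_a ≤ 2β·√(x_aᵀ A⁻¹ x_a). -/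
open Matrix Finset

/-- Cauchy–Schwarz for the semi-inner product of a positive semidefinite real matrix. -/
lemma Matrix.PosSemidef.dotProduct_mulVec_sq_le {n : Type*} [Fintype n] {M : Matrix n n ℝ}
    (hM : M.PosSemidef) (u w : n → ℝ) :
    (u ⬝ᵥ M *ᵥ w) ^ 2 ≤ (u ⬝ᵥ M *ᵥ u) * (w ⬝ᵥ M *ᵥ w) := by
  have hsymm : w ⬝ᵥ M *ᵥ u = u ⬝ᵥ M *ᵥ w := by
    have hT : Mᵀ = M := hM.isHermitian
    rw [dotProduct_mulVec, ← mulVec_transpose, hT, dotProduct_comm]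
  have hquad (t : ℝ) :
      0 ≤ (w ⬝ᵥ M *ᵥ w) * (t * t) + 2 * (u ⬝ᵥ M *ᵥ w) * t + u ⬝ᵥ M *ᵥ u := by
    have h := hM.dotProduct_mulVec_nonneg (u + t • w)
    simp only [star_trivial, mulVec_add, mulVec_smul, add_dotProduct, dotProduct_add,
      smul_dotProduct, dotProduct_smul, smul_eq_mul, hsymm] at h
    linarith
  have hdiscrim := discrim_le_zero hquad
  rw [discrim] at hdiscrim
  linarith

/-- Duality between the norms induced by `M` and `M⁻¹`. -/
lemma Matrix.PosDef.abs_dotProduct_le {n : Type*} [Fintype n] [DecidableEq n]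
    {M : Matrix n n ℝ} (hM : M.PosDef) (v u : n → ℝ) :
    |v ⬝ᵥ u| ≤ √(u ⬝ᵥ M *ᵥ u) * √(v ⬝ᵥ M⁻¹ *ᵥ v) := by
  have hcancel : M *ᵥ (M⁻¹ *ᵥ v) = v := by
    rw [mulVec_mulVec, mul_nonsing_inv _ ((isUnit_iff_isUnit_det _).mp hM.isUnit), one_mulVec]
  have h := hM.posSemidef.dotProduct_mulVec_sq_le u (M⁻¹ *ᵥ v)
  rw [hcancel, dotProduct_comm u v, dotProduct_comm _ v] at h
  have hu : 0 ≤ u ⬝ᵥ M *ᵥ u := hM.posSemidef.dotProduct_mulVec_nonneg u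
  rw [← Real.sqrt_mul hu]
  exact Real.abs_le_sqrt h

/-- One-step regret bound for LinUCB (Lemma 2): on the confidence event
`‖θ̂ − θ*‖_A ≤ β`, if `a` maximizes the UCB score over the candidate set `C`
and `j*` maximizes the expected reward `μ_j = x_jᵀθ*` over `C`, then
`μ_{j*} − μ_a ≤ 2β·√(x_aᵀ A⁻¹ x_a)`. -/
theorem linucb_one_step_regret
    {d : ℕ} {ι : Type*} (A : Matrix (Fin d) (Fin d) ℝ) (hA : A.PosDef)
    (θhat θstar : Fin d → ℝ) (β : ℝ) (hβ : 0 ≤ β)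
    (hconf : Real.sqrt ((θhat - θstar) ⬝ᵥ A *ᵥ (θhat - θstar)) ≤ β)
    (C : Finset ι) (hC : C.Nonempty)
    (x : ι → Fin d → ℝ)
    (μ : ι → ℝ) (hμ : ∀ j ∈ C, μ j = x j ⬝ᵥ θstar)
    (UCB : ι → ℝ)
    (hUCB : ∀ j ∈ C,
      UCB j = x j ⬝ᵥ θhat + β * Real.sqrt (x j ⬝ᵥ A⁻¹ *ᵥ x j))
    (a : ι) (ha : a ∈ C) (hamax : ∀ j ∈ C, UCB j ≤ UCB a)
    (jstar : ι) (hjstar : jstar ∈ C) (hjmax : ∀ j ∈ C, μ j ≤ μ jstar) :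
    μ jstar - μ a ≤ 2 * β * Real.sqrt (x a ⬝ᵥ A⁻¹ *ᵥ x a) := by
  have hbound (j : ι) :
      |x j ⬝ᵥ θhat - x j ⬝ᵥ θstar| ≤ β * √(x j ⬝ᵥ A⁻¹ *ᵥ x j) := by
    rw [← dotProduct_sub]
    exact (hA.abs_dotProduct_le _ _).trans (by gcongr)
  have hopt := hamax jstar hjstar
  rw [hUCB _ hjstar, hUCB _ ha] at hopt
  rw [hμ _ hjstar, hμ _ ha]
  linarith [(abs_le.mp (hbound jstar)).1, (abs_le.mp (hbound a)).2]
end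

section
/- Elliptical potential lemma, determinant form (Lemma 3, first inequality). Let λ > 0, A_0 = λ I_d, and for t = 1, …, T let A_t = A_{t−1} + x_t x_tᵀ where x_t ∈ ℝ^d. Then Σ_{t=1}^{T} min{1, x_tᵀ A_{t−1}⁻¹ x_t} ≤ 2·log( det(A_T) / det(A_0) ). -/
open Matrix Finset

/-- The determinant of a rank-one update of an invertible matrix. -/
theorem det_add_vecMulVec_eq {n R : Type*} [Fintype n] [DecidableEq n] [CommRing R]
    {M : Matrix n n R} (hM : IsUnit M.det) (u v : n → R) :
    (M + vecMulVec u v).det = M.det * (1 + v ⬝ᵥ M⁻¹ *ᵥ u) := by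
  rw [vecMulVec_eq Unit, det_add_replicateCol_mul_replicateRow hM, det_unique (n := Unit),
    Matrix.add_apply, Matrix.one_apply_eq, Matrix.mul_assoc, ← replicateCol_mulVec,
    replicateRow_mul_replicateCol_apply]

theorem min_one_le_two_mul_log_one_add {w : ℝ} (hw : 0 ≤ w) :
    min 1 w ≤ 2 * Real.log (1 + w) := by
  have hm0 : 0 ≤ min 1 w := le_min zero_le_one hw
  have hm1 : min 1 w ≤ 1 := min_le_left 1 w
  have hmw : min 1 w ≤ w := min_le_right 1 w
  generalize min 1 w = m at *
  have hlog : Real.log (1 + m) ≤ Real.log (1 + w) :=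
    Real.log_le_log (by linarith) (by linarith)
  have hinv := Real.one_sub_inv_le_log_of_pos (show 0 < 1 + m by linarith)
  have hhalf : m / 2 ≤ 1 - (1 + m)⁻¹ := by
    have h : 1 - (1 + m)⁻¹ - m / 2 = m * (1 - m) / (2 * (1 + m)) := by
      field_simp
      ring
    have : 0 ≤ m * (1 - m) / (2 * (1 + m)) :=
      div_nonneg (mul_nonneg hm0 (by linarith)) (by linarith)
    linarith
  linarith

/-- Elliptical potential lemma, determinant form (Lemma 3, first inequality):
for the ridge-initialized design matrices `A_0 = λ I`, `A_t = A_{t−1} + x_t x_tᵀ`,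
`Σ_{t=1}^T min{1, x_tᵀ A_{t−1}⁻¹ x_t} ≤ 2·log(det(A_T)/det(A_0))`. -/
theorem elliptical_potential_det
    {d : ℕ} (T : ℕ) (lam : ℝ) (hlam : 0 < lam)
    (x : ℕ → Fin d → ℝ)
    (A : ℕ → Matrix (Fin d) (Fin d) ℝ)
    (hA0 : A 0 = lam • (1 : Matrix (Fin d) (Fin d) ℝ))
    (hArec : ∀ t < T, A (t + 1) = A t + vecMulVec (x (t + 1)) (x (t + 1))) :
    ∑ t ∈ Finset.range T,
        min 1 (x (t + 1) ⬝ᵥ (A t)⁻¹ *ᵥ x (t + 1)) ≤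
      2 * Real.log ((A T).det / (A 0).det) := by
  have hpos : ∀ t ≤ T, (A t).PosDef := by
    intro t
    induction t with
    | zero =>
      intro _
      rw [hA0]
      exact PosDef.one.smul hlam
    | succ t ih =>
      intro ht
      rw [hArec t ht]
      exact (ih (Nat.le_of_succ_le ht)).add_posSemidef
        (by simpa using posSemidef_vecMulVec_self_star (x (t + 1)))
  have hdet : ∀ t ≤ T, 0 < (A t).det := fun t ht => (hpos t ht).det_pos
  have hstep : ∀ t ∈ Finset.range T, min 1 (x (t + 1) ⬝ᵥ (A t)⁻¹ *ᵥ x (t + 1)) ≤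
      2 * (Real.log (A (t + 1)).det - Real.log (A t).det) := by
    intro t ht
    have htT : t < T := Finset.mem_range.mp ht
    have hw : 0 ≤ x (t + 1) ⬝ᵥ (A t)⁻¹ *ᵥ x (t + 1) := by
      simpa using (hpos t htT.le).inv.posSemidef.dotProduct_mulVec_nonneg (x (t + 1))
    have hne : (A t).det ≠ 0 := (hdet t htT.le).ne'
    rw [hArec t htT, det_add_vecMulVec_eq hne.isUnit, Real.log_mul hne (by linarith),
      add_sub_cancel_left]
    exact min_one_le_two_mul_log_one_add hw
  refine (Finset.sum_le_sum hstep).trans_eq ?_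
  rw [← Finset.mul_sum, Finset.sum_range_sub (fun t => Real.log (A t).det),
    Real.log_div (hdet T le_rfl).ne' (hdet 0 T.zero_le).ne']
end

section
/- Cumulative regret bound for LinUCB on the confidence event (Theorem 1, deterministic core). Let d, T ∈ ℕ, λ ≥ 1, and β_0 ≤ β_1 ≤ … ≤ β_T be nonnegative reals. For each round t = 1, …, T, let C_t be a finite nonempty candidate set, each arm j ∈ C_t having a context x_{j,t} ∈ ℝ^d with ‖x_{j,t}‖₂ ≤ 1 and expected reward μ_{j,t} = x_{j,t}ᵀθ* for a fixed θ* ∈ ℝ^d. Define A_0 = λ I_d, A_t = A_{t−1} + x_{a_t,t} x_{a_t,t}ᵀ, where a_t ∈ C_t maximizes UCB_{j,t} = x_{j,t}ᵀθ̂_{t−1} + β_{t−1}·√(x_{j,t}ᵀ A_{t−1}⁻¹ x_{j,t}) over j ∈ C_t, for some vectors θ̂_0, …, θ̂_{T−1} ∈ ℝ^d. Suppose that an arm j_t* maximizing μ_{j,t} over j ∈ C_t belongs to C_t for every t, and that the confidence-ellipsoid condition ‖θ̂_{t−1} − θ*‖_{A_{t−1}} ≤ β_{t−1} holds for all t = 1,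 …, T, where ‖v‖_M = √(vᵀ M v). Then the cumulative regret Reg(T) = Σ_{t=1}^{T} (μ_{j_t*,t} − μ_{a_t,t}) satisfies Reg(T) ≤ 2·β_T·√( 2·T·d·log(1 + T/λ) ). -/
open Matrix Finset

section QuadraticForms

variable {n : Type*} [Fintype n]

theorem Matrix.PosSemidef.sq_dotProduct_mulVec_le {A : Matrix n n ℝ} (hA : A.PosSemidef)
    (y w : n → ℝ) : (y ⬝ᵥ A *ᵥ w) ^ 2 ≤ (y ⬝ᵥ A *ᵥ y) * (w ⬝ᵥ A *ᵥ w) := by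
  have hsymm : w ⬝ᵥ A *ᵥ y = y ⬝ᵥ A *ᵥ w := by
    have hT : Aᵀ = A := by simpa using hA.isHermitian.eq
    rw [dotProduct_mulVec, dotProduct_comm, ← mulVec_transpose, hT]
  have h := discrim_le_zero (a := w ⬝ᵥ A *ᵥ w) (b := 2 * (y ⬝ᵥ A *ᵥ w)) (c := y ⬝ᵥ A *ᵥ y)
    fun s => by
      have := hA.dotProduct_mulVec_nonneg (y + s • w)
      simp only [star_trivial, mulVec_add, mulVec_smul, add_dotProduct, dotProduct_add,
        smul_dotProduct, dotProduct_smul, smul_eq_mul, hsymm] at this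
      linarith
  rw [discrim] at h
  linarith

variable [DecidableEq n]

theorem Matrix.PosDef.abs_dotProduct_le_sqrt_mul_sqrt {A : Matrix n n ℝ} (hA : A.PosDef)
    (x w : n → ℝ) :
    |x ⬝ᵥ w| ≤ Real.sqrt (x ⬝ᵥ A⁻¹ *ᵥ x) * Real.sqrt (w ⬝ᵥ A *ᵥ w) := by
  have hdet : IsUnit A.det := (isUnit_iff_isUnit_det A).mp hA.isUnit
  have hT : Aᵀ = A := by simpa using hA.isHermitian.eq
  have hx : A *ᵥ (A⁻¹ *ᵥ x) = x := by rw [mulVec_mulVec, mul_nonsing_inv A hdet, one_mulVec]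
  have hw : (A⁻¹ *ᵥ x) ⬝ᵥ A *ᵥ w = x ⬝ᵥ w := by
    rw [dotProduct_mulVec, ← mulVec_transpose, hT, hx]
  have h := hA.posSemidef.sq_dotProduct_mulVec_le (A⁻¹ *ᵥ x) w
  rw [hw, hx, dotProduct_comm _ x] at h
  rw [← Real.sqrt_mul (by simpa using hA.inv.posSemidef.dotProduct_mulVec_nonneg x)]
  exact Real.abs_le_sqrt h

theorem Matrix.PosDef.dotProduct_inv_mulVec_le_one {A : Matrix n n ℝ} (hA : A.PosDef)
    (hA1 : (A - 1).PosSemidef) {x : n → ℝ} (hx : x ⬝ᵥ x ≤ 1) : x ⬝ᵥ A⁻¹ *ᵥ x ≤ 1 := by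
  have hdet : IsUnit A.det := (isUnit_iff_isUnit_det A).mp hA.isUnit
  have hAx : A *ᵥ (A⁻¹ *ᵥ x) = x := by rw [mulVec_mulVec, mul_nonsing_inv A hdet, one_mulVec]
  have h := hA1.dotProduct_mulVec_nonneg (A⁻¹ *ᵥ x)
  rw [star_trivial, sub_mulVec, hAx, one_mulVec, dotProduct_sub, dotProduct_comm _ x] at h
  have hsq := dotProduct_self_star_nonneg (x - A⁻¹ *ᵥ x)
  simp only [star_trivial, sub_dotProduct, dotProduct_sub, dotProduct_comm _ x] at hsq
  linarith

theorem Matrix.det_add_vecMulVec {A : Matrix n n ℝ} (hA : IsUnit A.det) (u v : n → ℝ) :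
    (A + vecMulVec u v).det = A.det * (1 + v ⬝ᵥ A⁻¹ *ᵥ u) := by
  rw [vecMulVec_eq Unit, det_add_replicateCol_mul_replicateRow hA]
  rw [Matrix.mul_assoc, ← replicateCol_mulVec]
  simp [replicateRow_mul_replicateCol_apply]

theorem Matrix.PosDef.log_det_le {A : Matrix n n ℝ} (hA : A.PosDef) {c : ℝ} (hc : 0 < c) :
    Real.log A.det ≤ A.trace / c - Fintype.card n + Fintype.card n * Real.log c := by
  have hdet : A.det = ∏ i, hA.1.eigenvalues i := by simpa using hA.1.det_eq_prod_eigenvalues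
  have htr : A.trace = ∑ i, hA.1.eigenvalues i := by simpa using hA.1.trace_eq_sum_eigenvalues
  rw [hdet, htr, Real.log_prod fun i _ => (hA.eigenvalues_pos i).ne']
  calc ∑ i, Real.log (hA.1.eigenvalues i)
      ≤ ∑ i, (hA.1.eigenvalues i / c - 1 + Real.log c) := by
        refine sum_le_sum fun i _ => ?_
        have h := Real.log_le_sub_one_of_pos (div_pos (hA.eigenvalues_pos i) hc)
        rw [Real.log_div (hA.eigenvalues_pos i).ne' hc.ne'] at h
        linarith
    _ = _ := by simp [sum_add_distrib, sum_sub_distrib, sum_div]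

end QuadraticForms

theorem Real.le_two_mul_log_one_add {v : ℝ} (h0 : 0 ≤ v) (h1 : v ≤ 1) :
    v ≤ 2 * Real.log (1 + v) := by
  have h := Real.one_sub_inv_le_log_of_pos (by linarith : 0 < 1 + v)
  have h2 : v / 2 ≤ 1 - (1 + v)⁻¹ := by
    rw [← sub_nonneg]
    have : 1 - (1 + v)⁻¹ - v / 2 = v * (1 - v) / (2 * (1 + v)) := by field_simp; ring
    rw [this]
    exact div_nonneg (mul_nonneg h0 (by linarith)) (by linarith)
  linarith

section DesignMatrix

variable {d : ℕ} {T : ℕ} {lam : ℝ} {A : ℕ → Matrix (Fin d) (Fin d) ℝ} {z : ℕ → Fin d → ℝ}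

theorem designMatrix_sub_posSemidef (hA0 : A 0 = lam • (1 : Matrix (Fin d) (Fin d) ℝ))
    (hA : ∀ t < T, A (t + 1) = A t + vecMulVec (z t) (z t)) :
    ∀ t ≤ T, (A t - lam • (1 : Matrix (Fin d) (Fin d) ℝ)).PosSemidef
  | 0, _ => by rw [hA0, sub_self]; exact .zero
  | t + 1, ht => by
    rw [hA t ht, add_sub_right_comm]
    exact (designMatrix_sub_posSemidef hA0 hA t (by lia)).add
      (by simpa using posSemidef_vecMulVec_self_star (z t))

theorem designMatrix_posDef (hlam : 0 < lam)
    (hA0 : A 0 = lam • (1 : Matrix (Fin d) (Fin d) ℝ))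
    (hA : ∀ t < T, A (t + 1) = A t + vecMulVec (z t) (z t)) {t : ℕ} (ht : t ≤ T) :
    (A t).PosDef := by
  simpa using PosDef.posSemidef_add (designMatrix_sub_posSemidef hA0 hA t ht)
    (PosDef.one.smul hlam)

theorem designMatrix_trace_le (hA0 : A 0 = lam • (1 : Matrix (Fin d) (Fin d) ℝ))
    (hA : ∀ t < T, A (t + 1) = A t + vecMulVec (z t) (z t))
    (hz : ∀ t < T, z t ⬝ᵥ z t ≤ 1) : ∀ t ≤ T, (A t).trace ≤ lam * d + t
  | 0, _ => by simp [hA0]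
  | t + 1, ht => by
    have h := designMatrix_trace_le hA0 hA hz t (by lia)
    have := hz t ht
    rw [hA t ht, trace_add, trace_vecMulVec]
    push_cast
    linarith

/-- The elliptical potential bound. -/
theorem sum_dotProduct_inv_mulVec_le_log_det (hlam : 1 ≤ lam)
    (hA0 : A 0 = lam • (1 : Matrix (Fin d) (Fin d) ℝ))
    (hA : ∀ t < T, A (t + 1) = A t + vecMulVec (z t) (z t))
    (hz : ∀ t < T, z t ⬝ᵥ z t ≤ 1) : ∀ t ≤ T,
    ∑ s ∈ range t, z s ⬝ᵥ (A s)⁻¹ *ᵥ z s ≤ 2 * (Real.log (A t).det - d * Real.log lam)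
  | 0, _ => by simp [hA0]
  | t + 1, ht => by
    have h := sum_dotProduct_inv_mulVec_le_log_det hlam hA0 hA hz t (by lia)
    have hpos := designMatrix_posDef (by linarith) hA0 hA (t := t) (by lia)
    have hv0 : 0 ≤ z t ⬝ᵥ (A t)⁻¹ *ᵥ z t := by
      simpa using hpos.inv.posSemidef.dotProduct_mulVec_nonneg (z t)
    have hsub : (A t - 1).PosSemidef := by
      have := (designMatrix_sub_posSemidef hA0 hA t (by lia)).add
        ((PosSemidef.one (n := Fin d) (R := ℝ)).smul (sub_nonneg.mpr hlam))
      rwa [sub_smul, one_smul, sub_add_sub_cancel] at this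
    have hlog := Real.le_two_mul_log_one_add hv0
      (hpos.dotProduct_inv_mulVec_le_one hsub (hz t ht))
    rw [sum_range_succ, hA t ht, det_add_vecMulVec hpos.det_pos.ne'.isUnit,
      Real.log_mul hpos.det_pos.ne' (by linarith)]
    linarith

theorem sum_dotProduct_inv_mulVec_le (hlam : 1 ≤ lam)
    (hA0 : A 0 = lam • (1 : Matrix (Fin d) (Fin d) ℝ))
    (hA : ∀ t < T, A (t + 1) = A t + vecMulVec (z t) (z t))
    (hz : ∀ t < T, z t ⬝ᵥ z t ≤ 1) :
    ∑ s ∈ range T, z s ⬝ᵥ (A s)⁻¹ *ᵥ z s ≤ 2 * (d * Real.log (1 + T / lam)) := by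
  rcases Nat.eq_zero_or_pos d with rfl | hd
  · simp [dotProduct]
  have hlam0 : 0 < lam := by linarith
  have hc : 0 < lam + T := by positivity
  refine (sum_dotProduct_inv_mulVec_le_log_det hlam hA0 hA hz T le_rfl).trans ?_
  have hlog := (designMatrix_posDef hlam0 hA0 hA le_rfl).log_det_le hc
  have htr : (A T).trace / (lam + T) ≤ d := by
    rw [div_le_iff₀ hc]
    have h1 : (1 : ℝ) ≤ d := by exact_mod_cast hd
    have hT : (0 : ℝ) ≤ T := T.cast_nonneg
    nlinarith [designMatrix_trace_le hA0 hA hz T le_rfl]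
  have hsplit : 1 + T / lam = (lam + T) / lam := by field_simp
  rw [hsplit, Real.log_div hc.ne' hlam0.ne']
  rw [Fintype.card_fin] at hlog
  linarith

end DesignMatrix

open Matrix Finset
/-- Cumulative regret bound for LinUCB on the confidence event (Theorem 1,
deterministic core): with ridge design matrices `A_0 = λ I`,
`A_t = A_{t−1} + x_{a_t,t} x_{a_t,t}ᵀ` (λ ≥ 1), bounded contexts, UCB-optimal
selections `a_t`, optimal candidate arms `j_t* ∈ C_t`, nondecreasing
nonnegative exploration coefficients `β_0 ≤ … ≤ β_T`, and the confidence
condition `‖θ̂_{t−1} − θ*‖_{A_{t−1}} ≤ β_{t−1}` for all rounds, the cumulative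
regret satisfies `Reg(T) ≤ 2 β_T √(2 T d log(1 + T/λ))`. -/
theorem linucb_cumulative_regret
    {d : ℕ} {ι : Type*} (T : ℕ) (lam : ℝ) (hlam : 1 ≤ lam)
    (β : ℕ → ℝ)
    (hβ0 : ∀ t ≤ T, 0 ≤ β t)
    (hβmono : ∀ s t : ℕ, s ≤ t → t ≤ T → β s ≤ β t)
    (C : ℕ → Finset ι)
    (hC : ∀ t, 1 ≤ t → t ≤ T → (C t).Nonempty)
    (x : ℕ → ι → Fin d → ℝ)
    (hx : ∀ t, 1 ≤ t → t ≤ T → ∀ j ∈ C t, Real.sqrt (x t j ⬝ᵥ x t j) ≤ 1)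
    (θstar : Fin d → ℝ)
    (μ : ℕ → ι → ℝ)
    (hμ : ∀ t, 1 ≤ t → t ≤ T → ∀ j ∈ C t, μ t j = x t j ⬝ᵥ θstar)
    (θhat : ℕ → Fin d → ℝ)
    (a : ℕ → ι)
    (A : ℕ → Matrix (Fin d) (Fin d) ℝ)
    (hA0 : A 0 = lam • (1 : Matrix (Fin d) (Fin d) ℝ))
    (hArec : ∀ t, 1 ≤ t → t ≤ T →
      A t = A (t - 1) + vecMulVec (x t (a t)) (x t (a t)))
    (ha : ∀ t, 1 ≤ t → t ≤ T → a t ∈ C t)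
    (hamax : ∀ t, 1 ≤ t → t ≤ T → ∀ j ∈ C t,
      x t j ⬝ᵥ θhat (t - 1) +
          β (t - 1) * Real.sqrt (x t j ⬝ᵥ (A (t - 1))⁻¹ *ᵥ x t j) ≤
        x t (a t) ⬝ᵥ θhat (t - 1) +
          β (t - 1) * Real.sqrt (x t (a t) ⬝ᵥ (A (t - 1))⁻¹ *ᵥ x t (a t)))
    (jstar : ℕ → ι)
    (hjstar : ∀ t, 1 ≤ t → t ≤ T → jstar t ∈ C t)
    (hjmax : ∀ t, 1 ≤ t → t ≤ T → ∀ j ∈ C t, μ t j ≤ μ t (jstar t))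
    (hconf : ∀ t, 1 ≤ t → t ≤ T →
      Real.sqrt ((θhat (t - 1) - θstar) ⬝ᵥ
          A (t - 1) *ᵥ (θhat (t - 1) - θstar)) ≤ β (t - 1)) :
    ∑ t ∈ Finset.Icc 1 T, (μ t (jstar t) - μ t (a t)) ≤
      2 * β T * Real.sqrt (2 * T * d * Real.log (1 + T / lam)) := by
  have hA : ∀ t < T, A (t + 1) =
      A t + vecMulVec (x (t + 1) (a (t + 1))) (x (t + 1) (a (t + 1))) :=
    fun t ht => by simpa using hArec (t + 1) (by lia) ht
  have hz : ∀ t < T, x (t + 1) (a (t + 1)) ⬝ᵥ x (t + 1) (a (t + 1)) ≤ 1 := fun t ht => by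
    simpa using hx (t + 1) (by lia) ht _ (ha (t + 1) (by lia) ht)
  have hpot := sum_dotProduct_inv_mulVec_le (z := fun t => x (t + 1) (a (t + 1))) hlam hA0 hA hz
  have hpos : ∀ t < T, (A t).PosDef := fun t ht =>
    designMatrix_posDef (z := fun t => x (t + 1) (a (t + 1))) (by linarith) hA0 hA ht.le
  have hround : ∀ t < T, μ (t + 1) (jstar (t + 1)) - μ (t + 1) (a (t + 1)) ≤ 2 * β T *
      Real.sqrt (x (t + 1) (a (t + 1)) ⬝ᵥ (A t)⁻¹ *ᵥ x (t + 1) (a (t + 1))) := by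
    intro t ht
    have h1 : 1 ≤ t + 1 := by lia
    have hdev : ∀ j, |x (t + 1) j ⬝ᵥ (θhat t - θstar)| ≤
        β t * Real.sqrt (x (t + 1) j ⬝ᵥ (A t)⁻¹ *ᵥ x (t + 1) j) := fun j => by
      refine ((hpos t ht).abs_dotProduct_le_sqrt_mul_sqrt _ _).trans ?_
      rw [mul_comm]
      exact mul_le_mul_of_nonneg_right (by simpa using hconf (t + 1) h1 ht) (Real.sqrt_nonneg _)
    have hopt := neg_le_of_abs_le (hdev (jstar (t + 1)))
    have hsel := le_of_abs_le (hdev (a (t + 1)))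
    have hucb := hamax (t + 1) h1 ht _ (hjstar (t + 1) h1 ht)
    rw [dotProduct_sub] at hopt hsel
    rw [Nat.add_sub_cancel] at hucb
    have hβ := mul_le_mul_of_nonneg_right (hβmono t T ht.le le_rfl)
      (Real.sqrt_nonneg (x (t + 1) (a (t + 1)) ⬝ᵥ (A t)⁻¹ *ᵥ x (t + 1) (a (t + 1))))
    rw [hμ _ h1 ht _ (hjstar _ h1 ht), hμ _ h1 ht _ (ha _ h1 ht)]
    linarith
  have hcs : ∑ t ∈ range T,
      Real.sqrt (x (t + 1) (a (t + 1)) ⬝ᵥ (A t)⁻¹ *ᵥ x (t + 1) (a (t + 1))) ≤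
      Real.sqrt (2 * T * d * Real.log (1 + T / lam)) := by
    refine Real.le_sqrt_of_sq_le (sq_sum_le_card_mul_sum_sq.trans ?_)
    rw [card_range, sum_congr rfl fun t ht => Real.sq_sqrt (by
      simpa using (hpos t (mem_range.mp ht)).inv.posSemidef.dotProduct_mulVec_nonneg
        (x (t + 1) (a (t + 1))))]
    calc _ ≤ (T : ℝ) * (2 * (d * Real.log (1 + T / lam))) :=
          mul_le_mul_of_nonneg_left hpot T.cast_nonneg
      _ = _ := by ring
  rw [← Ico_add_one_right_eq_Icc, sum_Ico_eq_sum_range, Nat.add_sub_cancel]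
  simp only [add_comm 1]
  calc _ ≤ _ := sum_le_sum fun t ht => hround t (mem_range.mp ht)
    _ ≤ _ := by
      rw [← mul_sum]
      exact mul_le_mul_of_nonneg_left hcs (mul_nonneg zero_le_two (hβ0 T le_rfl))
end
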